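/- Define Υ : ℝ → ℝ by Υ(η) = (1 + √π · η · e^{η²} · erfc(−η)) / (e^{η²} · erfc(−η)). Then e^{η²}·erfc(−η) > 0 for every η ∈ ℝ, Υ is strictly positive and strictly monotone increasing on ℝ, Υ(η) → 0 as η → −∞, and Υ(η) → +∞ as η → +∞. Consequently, for every t > 0 the equation Υ(η) = t has a unique solution η ∈ ℝ. -/

import Mathlib

open MeasureTheory

/-- The complementary error function `erfc(x) = (2/√π) ∫_x^∞ e^{-t²} dt`. -/
noncomputable def erfc (x : ℝ) : ℝ :=
  (2 / Real.sqrt Real.pi) * ∫ t in Set.Ioi x, Real.exp (-t ^ 2)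

/-- The function `Υ(η) = (1 + √π η e^{η²} erfc(-η)) / (e^{η²} erfc(-η))`. -/
noncomputable def Upsilon (η : ℝ) : ℝ :=
  (1 + Real.sqrt Real.pi * η * Real.exp (η ^ 2) * erfc (-η)) /
    (Real.exp (η ^ 2) * erfc (-η))

noncomputable def FF (x : ℝ) : ℝ := ∫ t in Set.Iic x, Real.exp (-t ^ 2)

noncomputable def HH (x : ℝ) : ℝ := Real.exp (-x ^ 2) / 2 + x * FF x

lemma gauss_integrable : Integrable (fun t : ℝ => Real.exp (-t ^ 2)) := by
  simpa using integrable_exp_neg_mul_sq (b := 1) one_pos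

lemma erfc_neg_eq (x : ℝ) : erfc (-x) = 2 / Real.sqrt Real.pi * FF x := by
  unfold erfc FF
  have h := integral_comp_neg_Iic x (fun t : ℝ => Real.exp (-t ^ 2))
  simp only [neg_sq] at h
  rw [h]

lemma gauss_deriv (x : ℝ) :
    HasDerivAt (fun t : ℝ => Real.exp (-t ^ 2)) (-2 * x * Real.exp (-x ^ 2)) x := by
  have h : HasDerivAt (fun t : ℝ => -t ^ 2) (-(2 * x)) x := by
    exact (hasDerivAt_pow 2 x).neg.congr_deriv (by norm_num)
  convert h.exp using 1
  ring

lemma FF_deriv (x : ℝ) : HasDerivAt FF (Real.exp (-x ^ 2)) x := by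
  have hc : Continuous (fun t : ℝ => Real.exp (-t ^ 2)) := by fun_prop
  have h : FF = fun y => FF 0 + ∫ t in (0 : ℝ)..y, Real.exp (-t ^ 2) := by
    funext y
    have := intervalIntegral.integral_Iic_sub_Iic (μ := volume) (a := 0) (b := y)
      gauss_integrable.integrableOn gauss_integrable.integrableOn
    unfold FF
    rw [← this]
    ring
  rw [h]
  exact (hc.integral_hasStrictDerivAt 0 x).hasDerivAt.const_add _

lemma HH_deriv (x : ℝ) : HasDerivAt HH (FF x) x := by
  have h := ((gauss_deriv x).div_const 2).add ((hasDerivAt_id x).mul (FF_deriv x))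
  refine h.congr_deriv ?_
  simp only [id]
  ring

lemma FF_nonneg (x : ℝ) : 0 ≤ FF x := integral_nonneg fun _ => (Real.exp_pos _).le

lemma pos_of_deriv {f f' : ℝ → ℝ} (hf : ∀ x, HasDerivAt f (f' x) x) (hp : ∀ x, 0 < f' x)
    (hl : Filter.Tendsto f Filter.atBot (nhds 0)) (x : ℝ) : 0 < f x := by
  have hm : StrictMono f := strictMono_of_hasDerivAt_pos hf hp
  exact lt_of_le_of_lt (hm.monotone.le_of_tendsto hl (x - 1)) (hm (by linarith))

lemma gauss_le {x : ℝ} (hx : x ≤ -1) : Real.exp (-x ^ 2) ≤ Real.exp x := by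
  apply Real.exp_le_exp.2
  nlinarith

lemma FF_le {x : ℝ} (hx : x ≤ -1) : FF x ≤ Real.exp x := by
  rw [← integral_exp_Iic x]
  apply setIntegral_mono_on gauss_integrable.integrableOn (integrableOn_exp_Iic x)
    measurableSet_Iic
  intro t ht
  exact gauss_le (le_trans ht hx)

lemma pow_exp_atBot (n : ℕ) :
    Filter.Tendsto (fun x : ℝ => |x| ^ n * Real.exp x) Filter.atBot (nhds 0) := by
  have h := (Real.tendsto_pow_mul_exp_neg_atTop_nhds_zero n).comp Filter.tendsto_neg_atBot_atTop
  refine h.congr' ?_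
  filter_upwards [Filter.eventually_le_atBot (0 : ℝ)] with x hx
  simp [abs_of_nonpos hx]

lemma lim_aux {f : ℝ → ℝ} (h0 : ∀ x, 0 ≤ f x) (h1 : ∀ x, x ≤ -1 → f x ≤ Real.exp x) (n : ℕ) :
    Filter.Tendsto (fun x : ℝ => x ^ n * f x) Filter.atBot (nhds 0) := by
  refine squeeze_zero_norm' ?_ (pow_exp_atBot n)
  filter_upwards [Filter.eventually_le_atBot (-1 : ℝ)] with x hx
  rw [norm_mul, norm_pow, Real.norm_eq_abs, Real.norm_eq_abs, abs_of_nonneg (h0 x)]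
  exact mul_le_mul_of_nonneg_left (h1 x hx) (by positivity)

lemma limF (n : ℕ) : Filter.Tendsto (fun x : ℝ => x ^ n * FF x) Filter.atBot (nhds 0) :=
  lim_aux FF_nonneg (fun _ h => FF_le h) n

lemma limG (n : ℕ) :
    Filter.Tendsto (fun x : ℝ => x ^ n * Real.exp (-x ^ 2)) Filter.atBot (nhds 0) :=
  lim_aux (fun _ => (Real.exp_pos _).le) (fun _ h => gauss_le h) n

lemma FF_pos (x : ℝ) : 0 < FF x :=
  pos_of_deriv FF_deriv (fun _ => Real.exp_pos _) (by simpa using limF 0) x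

lemma HH_lim : Filter.Tendsto HH Filter.atBot (nhds 0) := by
  have h := ((limG 0).div_const 2).add (limF 1)
  simp only [pow_zero, one_mul, pow_one, zero_div, add_zero] at h
  exact h

lemma HH_pos (x : ℝ) : 0 < HH x := pos_of_deriv HH_deriv FF_pos HH_lim x

lemma LL_deriv (x : ℝ) : HasDerivAt (fun y => FF y + 2 * (y * HH y)) (4 * HH x) x := by
  have h := (FF_deriv x).add (((hasDerivAt_id x).mul (HH_deriv x)).const_mul 2)
  refine h.congr_deriv ?_
  simp only [id, HH]
  ring

lemma LL_pos (x : ℝ) : 0 < FF x + 2 * (x * HH x) := by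
  refine pos_of_deriv LL_deriv (fun x => by have := HH_pos x; positivity) ?_ x
  have h := ((limF 0).add (limG 1)).add ((limF 2).const_mul 2)
  simp only [add_zero, mul_zero] at h
  refine h.congr fun y => ?_
  simp only [HH]
  ring

lemma KK_pos (x : ℝ) : 0 < FF x * FF x - HH x * Real.exp (-x ^ 2) := by
  refine pos_of_deriv (f := fun x => FF x * FF x - HH x * Real.exp (-x ^ 2))
    (f' := fun x => Real.exp (-x ^ 2) * (FF x + 2 * (x * HH x))) (fun x => ?_)
    (fun x => mul_pos (Real.exp_pos _) (LL_pos x)) ?_ x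
  · refine (((FF_deriv x).mul (FF_deriv x)).sub ((HH_deriv x).mul (gauss_deriv x))).congr_deriv ?_
    ring
  · have hF := limF 0
    have hG := limG 0
    have h := (hF.mul hF).sub (HH_lim.mul hG)
    simpa using h

lemma Upsilon_eq (x : ℝ) : Upsilon x = Real.sqrt Real.pi * (HH x / FF x) := by
  have h1 : Real.sqrt Real.pi ≠ 0 := (Real.sqrt_pos.2 Real.pi_pos).ne'
  have h2 := (FF_pos x).ne'
  have h3 := (Real.exp_pos (x ^ 2)).ne'
  unfold Upsilon HH
  rw [erfc_neg_eq, Real.exp_neg]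
  field_simp

lemma Upsilon_deriv (x : ℝ) : HasDerivAt Upsilon
    (Real.sqrt Real.pi * ((FF x * FF x - HH x * Real.exp (-x ^ 2)) / FF x ^ 2)) x := by
  rw [show Upsilon = _ from funext Upsilon_eq]
  exact ((HH_deriv x).div (FF_deriv x) (FF_pos x).ne').const_mul _

theorem stmt_4 :
    (∀ η : ℝ, 0 < Real.exp (η ^ 2) * erfc (-η)) ∧
    (∀ η : ℝ, 0 < Upsilon η) ∧
    StrictMono Upsilon ∧
    Filter.Tendsto Upsilon Filter.atBot (nhds 0) ∧
    Filter.Tendsto Upsilon Filter.atTop Filter.atTop ∧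
    (∀ t : ℝ, 0 < t → ∃! η : ℝ, Upsilon η = t) := by
  have hs : 0 < Real.sqrt Real.pi := Real.sqrt_pos.2 Real.pi_pos
  have hpos : ∀ η : ℝ, 0 < Upsilon η := fun η => by
    rw [Upsilon_eq]
    exact mul_pos hs (div_pos (HH_pos η) (FF_pos η))
  have hmono : StrictMono Upsilon := strictMono_of_hasDerivAt_pos Upsilon_deriv fun x =>
    mul_pos hs (div_pos (KK_pos x) (pow_pos (FF_pos x) 2))
  have hbot : Filter.Tendsto Upsilon Filter.atBot (nhds 0) := by
    have hl : Filter.Tendsto (fun x : ℝ => Real.sqrt Real.pi / 2 * (-x)⁻¹) Filter.atBot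
        (nhds 0) := by
      simpa using (tendsto_inv_atTop_zero.comp
        Filter.tendsto_neg_atBot_atTop).const_mul (Real.sqrt Real.pi / 2)
    refine squeeze_zero' (Filter.Eventually.of_forall fun x => (hpos x).le) ?_ hl
    filter_upwards [Filter.eventually_lt_atBot (0 : ℝ)] with x hx
    rw [Upsilon_eq, div_mul_eq_mul_div, mul_div_assoc]
    refine mul_le_mul_of_nonneg_left ?_ hs.le
    rw [div_le_iff₀ (FF_pos x)]
    have hx' : 0 < -x := by linarith
    have := LL_pos x
    rw [div_mul_eq_mul_div, inv_mul_eq_div, div_div, le_div_iff₀ (by positivity)]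
    nlinarith
  have htop : Filter.Tendsto Upsilon Filter.atTop Filter.atTop := by
    refine Filter.tendsto_atTop_mono (fun x => ?_) (Filter.tendsto_id.const_mul_atTop hs)
    rw [Upsilon_eq]
    refine mul_le_mul_of_nonneg_left ?_ hs.le
    rw [le_div_iff₀ (FF_pos x)]
    have := Real.exp_pos (-x ^ 2)
    simp only [id, HH]
    linarith
  refine ⟨fun η => ?_, hpos, hmono, hbot, htop, fun t ht => ?_⟩
  · rw [erfc_neg_eq]
    have := FF_pos η
    positivity
  · have hc : Continuous Upsilon :=
      continuous_iff_continuousAt.2 fun x => (Upsilon_deriv x).continuousAt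
    obtain ⟨a, ha⟩ := (hbot.eventually (gt_mem_nhds ht)).exists
    obtain ⟨b, hb⟩ := (htop.eventually (Filter.eventually_ge_atTop t)).exists
    obtain ⟨c, hc'⟩ := mem_range_of_exists_le_of_exists_ge hc ⟨a, le_of_lt ha⟩ ⟨b, hb⟩
    exact ⟨c, hc', fun y hy => hmono.injective (hy.trans hc'.symm)⟩
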